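/- arXiv:2604.03722 — 2 statements merged into one kernel-verified Lean document; each statement's English description precedes it below -/
import Mathlib

section
/- Consider the physical fractional Brownian motion model with Hurst parameter H ∈ (0,1), noise intensity σ > 0 and fixed horizon T > 0. If the sampling rate is coupled by δ = ε^α with α > max{1, 2(1−H)}, then E[σ̂²_{ε,ε^α}] → 0 as ε → 0⁺ (along values of ε for which N = T/ε^α is a positive integer); in other words, the estimator is asymptotically biased towards zero under too-fast sampling. -/
open MeasureTheory ProbabilityTheory Filter Matrix Topology

noncomputable section

/-- Covariance function of two-sided fractional Brownian motion with Hurst parameter `H`. -/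
def fbmCov (H s t : ℝ) : ℝ :=
  (|s| ^ (2 * H) + |t| ^ (2 * H) - |s - t| ^ (2 * H)) / 2

/-- `B` is a two-sided fractional Brownian motion with Hurst parameter `H`:
a.s. continuous paths, `B 0 = 0`, and all finite-dimensional marginals are centered
Gaussian with covariance `fbmCov H`. -/
structure IsTwoSidedFBM {Ω : Type*} [MeasureSpace Ω] (H : ℝ) (B : ℝ → Ω → ℝ) : Prop where
  meas : ∀ t, Measurable (B t)
  cont : ∀ᵐ ω : Ω, Continuous fun t => B t ω
  zero : ∀ᵐ ω : Ω, B 0 ω = 0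
  gaussian : ∀ (n : ℕ) (t a : Fin n → ℝ),
    Measure.map (fun ω => ∑ i, a i * B (t i) ω) (ℙ : Measure Ω)
      = gaussianReal 0 (∑ i, ∑ j, a i * a j * fbmCov H (t i) (t j)).toNNReal

/-- The stationary fractional Ornstein–Uhlenbeck process
`Y^ε_t = (σ/ε^H)(B^H_t − (1/ε)∫_{−∞}^t e^{−(t−s)/ε} B^H_s ds)`. -/
def fracOU {Ω : Type*} [MeasureSpace Ω] (H σ ε : ℝ) (B : ℝ → Ω → ℝ) (t : ℝ) (ω : Ω) : ℝ :=
  (σ / ε ^ H) * (B t ω - (1 / ε) * ∫ s in Set.Iic t, Real.exp (-(t - s) / ε) * B s ω)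

/-- The slow component `X^ε_t = ε^{H−1} ∫_0^t Y^ε_s ds` of the physical fractional
Brownian motion model. -/
def slowX {Ω : Type*} [MeasureSpace Ω] (H σ ε : ℝ) (B : ℝ → Ω → ℝ) (t : ℝ) (ω : Ω) : ℝ :=
  ε ^ (H - 1) * ∫ s in (0 : ℝ)..t, fracOU H σ ε B s ω

/-- Covariance matrix of the increments, over a grid of mesh `δ`, of fractional Brownian
motion with Hurst parameter `H`. -/
def SigmaH (H δ : ℝ) (N : ℕ) : Matrix (Fin N) (Fin N) ℝ := fun i j =>
  δ ^ (2 * H) / 2 *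
    (|(i : ℝ) - (j : ℝ) + 1| ^ (2 * H) + |(i : ℝ) - (j : ℝ) - 1| ^ (2 * H)
      - 2 * |(i : ℝ) - (j : ℝ)| ^ (2 * H))

/-- Vector of increments of the slow component over the grid of mesh `δ`. -/
def incVec {Ω : Type*} [MeasureSpace Ω] (H σ ε δ : ℝ) (B : ℝ → Ω → ℝ) (N : ℕ) (ω : Ω) :
    Fin N → ℝ := fun k =>
  slowX H σ ε B (((k : ℕ) + 1 : ℝ) * δ) ω - slowX H σ ε B ((k : ℕ) * δ) ω

/-- The maximum-likelihood-type estimator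
`σ̂²_{ε,δ} = (1/N) Vᵀ (Σ^H_{δ,N})⁻¹ V`. -/
def sigmaHat2 {Ω : Type*} [MeasureSpace Ω] (H σ ε δ : ℝ) (B : ℝ → Ω → ℝ) (N : ℕ) (ω : Ω) : ℝ :=
  (1 / (N : ℝ)) * (incVec H σ ε δ B N ω ⬝ᵥ ((SigmaH H δ N)⁻¹ *ᵥ incVec H σ ε δ B N ω))

theorem integrableOn_one_sub_cos_mul_rpow {H : ℝ} (hH : H ∈ Set.Ioo (0 : ℝ) 1) (t : ℝ) :
    IntegrableOn (fun ξ : ℝ => (1 - Real.cos (t * ξ)) * ξ ^ (-1 - 2 * H)) (Set.Ioi 0) := by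
  obtain ⟨h0, h1⟩ := hH
  have hmeas : Measurable (fun ξ : ℝ => (1 - Real.cos (t * ξ)) * ξ ^ (-1 - 2 * H)) := by
    fun_prop
  rw [← Set.Ioc_union_Ioi_eq_Ioi (zero_le_one' ℝ)]
  refine IntegrableOn.union ?_ ?_
  · have hi : IntegrableOn (fun ξ : ℝ => t ^ 2 / 2 * ξ ^ (1 - 2 * H)) (Set.Ioc 0 1) := by
      have := (intervalIntegral.intervalIntegrable_rpow' (a := 0) (b := 1)
        (show (-1 : ℝ) < 1 - 2 * H by linarith)).const_mul (t ^ 2 / 2)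
      rwa [intervalIntegrable_iff_integrableOn_Ioc_of_le zero_le_one] at this
    refine Integrable.mono' hi hmeas.aestronglyMeasurable ?_
    filter_upwards [ae_restrict_mem measurableSet_Ioc] with ξ hξ
    have hpow : ξ ^ (1 - 2 * H) = ξ ^ 2 * ξ ^ (-1 - 2 * H) := by
      rw [← Real.rpow_natCast, ← Real.rpow_add hξ.1]; norm_num; ring_nf
    have hcos := Real.one_sub_sq_div_two_le_cos (x := t * ξ)
    have hw : 0 ≤ ξ ^ (-1 - 2 * H) := Real.rpow_nonneg hξ.1.le _
    rw [Real.norm_of_nonneg (mul_nonneg (by linarith [Real.cos_le_one (t * ξ)]) hw), hpow,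
      ← mul_assoc]
    exact mul_le_mul_of_nonneg_right (by nlinarith) hw
  · have hi : IntegrableOn (fun ξ : ℝ => 2 * ξ ^ (-1 - 2 * H)) (Set.Ioi 1) :=
      (integrableOn_Ioi_rpow_of_lt (by linarith) one_pos).const_mul 2
    refine Integrable.mono' hi hmeas.aestronglyMeasurable ?_
    filter_upwards [ae_restrict_mem measurableSet_Ioi] with ξ hξ
    have hξ0 : (0 : ℝ) < ξ := one_pos.trans hξ
    have hw : 0 ≤ ξ ^ (-1 - 2 * H) := Real.rpow_nonneg hξ0.le _
    rw [Real.norm_of_nonneg (mul_nonneg (by linarith [Real.cos_le_one (t * ξ)]) hw)]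
    exact mul_le_mul_of_nonneg_right (by linarith [Real.neg_one_le_cos (t * ξ)]) hw

/-- The normalising constant `∫₀^∞ (1 - cos ξ) ξ^{-1-2H} dξ` in the spectral representation of
`|t|^{2H}`. -/
def spectralConst (H : ℝ) : ℝ :=
  ∫ ξ in Set.Ioi (0 : ℝ), (1 - Real.cos ξ) * ξ ^ (-1 - 2 * H)

theorem integral_one_sub_cos_mul_rpow {H : ℝ} (hH : 0 < H) (t : ℝ) :
    ∫ ξ in Set.Ioi (0 : ℝ), (1 - Real.cos (t * ξ)) * ξ ^ (-1 - 2 * H)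
      = |t| ^ (2 * H) * spectralConst H := by
  rcases eq_or_ne t 0 with rfl | ht
  · simp [Real.zero_rpow (show 2 * H ≠ 0 by positivity)]
  have hb : 0 < |t| := abs_pos.2 ht
  have key := integral_comp_mul_left_Ioi
    (fun u : ℝ => (1 - Real.cos u) * u ^ (-1 - 2 * H)) 0 hb
  rw [mul_zero, smul_eq_mul] at key
  have hcongr : ∫ ξ in Set.Ioi (0 : ℝ), (1 - Real.cos (|t| * ξ)) * (|t| * ξ) ^ (-1 - 2 * H)
      = |t| ^ (-1 - 2 * H) *
        ∫ ξ in Set.Ioi (0 : ℝ), (1 - Real.cos (t * ξ)) * ξ ^ (-1 - 2 * H) := by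
    rw [← integral_const_mul]
    refine setIntegral_congr_fun measurableSet_Ioi fun ξ hξ => ?_
    have hξ' : (0 : ℝ) < ξ := hξ
    have hcos : Real.cos (|t| * ξ) = Real.cos (t * ξ) := by
      rw [← Real.cos_abs (t * ξ), abs_mul, abs_of_pos hξ']
    simp only [hcos, Real.mul_rpow hb.le hξ'.le]
    ring
  rw [hcongr] at key
  have hp : |t| ^ (-1 - 2 * H) * (|t| ^ (2 * H) * |t|) = 1 := by
    rw [← Real.rpow_add_one hb.ne', ← Real.rpow_add hb]
    ring_nf
    simp
  have hne : |t| ^ (-1 - 2 * H) ≠ 0 := (Real.rpow_pos_of_pos hb _).ne'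
  refine mul_left_cancel₀ hne ?_
  rw [key, ← mul_assoc]
  change |t|⁻¹ * spectralConst H = _
  congr 1
  field_simp
  linarith

theorem spectralConst_pos {H : ℝ} (hH : H ∈ Set.Ioo (0 : ℝ) 1) : 0 < spectralConst H := by
  have hint := integrableOn_one_sub_cos_mul_rpow hH 1
  simp only [one_mul] at hint
  rw [spectralConst, setIntegral_pos_iff_support_of_nonneg_ae _ hint]
  · refine lt_of_lt_of_le ?_ (measure_mono (μ := volume) (s := Set.Ioo 0 Real.pi) ?_)
    · simp [Real.pi_pos]
    · intro ξ hξ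
      refine ⟨?_, hξ.1⟩
      have hc : Real.cos ξ < 1 := by
        rw [← Real.cos_zero]
        exact Real.cos_lt_cos_of_nonneg_of_le_pi le_rfl hξ.2.le hξ.1
      exact (mul_pos (by linarith) (Real.rpow_pos_of_pos hξ.1 _)).ne'
  · filter_upwards [ae_restrict_mem measurableSet_Ioi] with ξ hξ
    exact mul_nonneg (by linarith [Real.cos_le_one ξ]) (Real.rpow_nonneg (le_of_lt hξ) _)

/-- The periodogram `|∑ x_k e^{ikξ}|²` of a real vector. -/
def periodogram {N : ℕ} (x : Fin N → ℝ) (ξ : ℝ) : ℝ :=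
  ∑ i, ∑ j, x i * x j * Real.cos (((i : ℝ) - (j : ℝ)) * ξ)

theorem periodogram_eq {N : ℕ} (x : Fin N → ℝ) (ξ : ℝ) :
    periodogram x ξ =
      (∑ i, x i * Real.cos ((i : ℝ) * ξ)) ^ 2 + (∑ i, x i * Real.sin ((i : ℝ) * ξ)) ^ 2 := by
  simp only [periodogram, sq, Finset.sum_mul_sum, ← Finset.sum_add_distrib]
  refine Finset.sum_congr rfl fun i _ => Finset.sum_congr rfl fun j _ => ?_
  rw [sub_mul, Real.cos_sub]
  ring

theorem periodogram_nonneg {N : ℕ} (x : Fin N → ℝ) (ξ : ℝ) : 0 ≤ periodogram x ξ := by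
  rw [periodogram_eq]; positivity

theorem periodogram_le {N : ℕ} (x : Fin N → ℝ) (ξ : ℝ) :
    periodogram x ξ ≤ N * ∑ i, x i ^ 2 := by
  rw [periodogram_eq]
  have h1 := Finset.sum_mul_sq_le_sq_mul_sq Finset.univ x fun i => Real.cos ((i : ℝ) * ξ)
  have h2 := Finset.sum_mul_sq_le_sq_mul_sq Finset.univ x fun i => Real.sin ((i : ℝ) * ξ)
  refine (add_le_add h1 h2).trans_eq ?_
  rw [← mul_add, ← Finset.sum_add_distrib]
  simp [Real.cos_sq_add_sin_sq, mul_comm]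

theorem continuous_periodogram {N : ℕ} (x : Fin N → ℝ) : Continuous (periodogram x) := by
  unfold periodogram; fun_prop

theorem integral_periodogram {N : ℕ} (x : Fin N → ℝ) :
    ∫ ξ in (0 : ℝ)..Real.pi, periodogram x ξ = Real.pi * ∑ i, x i ^ 2 := by
  unfold periodogram
  rw [intervalIntegral.integral_finsetSum
    fun i _ => Continuous.intervalIntegrable (by fun_prop) _ _, Finset.mul_sum]
  refine Finset.sum_congr rfl fun i _ => ?_
  rw [intervalIntegral.integral_finsetSum
    fun j _ => Continuous.intervalIntegrable (by fun_prop) _ _]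
  rw [Finset.sum_eq_single i]
  · simp; ring
  · intro j _ hj
    have hne : ((i : ℝ) - (j : ℝ)) ≠ 0 := by
      rw [sub_ne_zero]; exact_mod_cast fun h => hj (Fin.ext h).symm
    have hsin : Real.sin (((i : ℝ) - (j : ℝ)) * Real.pi) = 0 := by
      have := Real.sin_int_mul_pi ((i : ℤ) - (j : ℤ))
      push_cast at this
      exact this
    rw [intervalIntegral.integral_const_mul,
      intervalIntegral.integral_comp_mul_left (fun u => Real.cos u) hne, integral_cos, hsin]
    simp
  · simp

theorem sigmaH_eq_integral {H : ℝ} (hH : H ∈ Set.Ioo (0 : ℝ) 1) (δ : ℝ) {N : ℕ}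
    (i j : Fin N) :
    IntegrableOn (fun ξ : ℝ => Real.cos (((i : ℝ) - (j : ℝ)) * ξ) *
      ((1 - Real.cos ξ) * ξ ^ (-1 - 2 * H))) (Set.Ioi 0) ∧
    spectralConst H * SigmaH H δ N i j = δ ^ (2 * H) * ∫ ξ in Set.Ioi (0 : ℝ),
      Real.cos (((i : ℝ) - (j : ℝ)) * ξ) * ((1 - Real.cos ξ) * ξ ^ (-1 - 2 * H)) := by
  set d : ℝ := (i : ℝ) - (j : ℝ) with hd
  have h1 := integrableOn_one_sub_cos_mul_rpow hH (d + 1)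
  have h2 := integrableOn_one_sub_cos_mul_rpow hH (d - 1)
  have h3 := integrableOn_one_sub_cos_mul_rpow hH d
  have heq : (fun ξ : ℝ => Real.cos (d * ξ) * ((1 - Real.cos ξ) * ξ ^ (-1 - 2 * H))) =
      fun ξ : ℝ => 1 / 2 * ((1 - Real.cos ((d + 1) * ξ)) * ξ ^ (-1 - 2 * H)
        + (1 - Real.cos ((d - 1) * ξ)) * ξ ^ (-1 - 2 * H))
        - (1 - Real.cos (d * ξ)) * ξ ^ (-1 - 2 * H) := by
    clear_value d
    funext ξ
    rw [add_mul d, sub_mul d, one_mul, Real.cos_add, Real.cos_sub]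
    ring
  have h12 : IntegrableOn (fun ξ : ℝ => 1 / 2 * ((1 - Real.cos ((d + 1) * ξ)) * ξ ^ (-1 - 2 * H)
        + (1 - Real.cos ((d - 1) * ξ)) * ξ ^ (-1 - 2 * H))) (Set.Ioi 0) :=
    (h1.add h2).const_mul (1 / 2)
  rw [heq]
  refine ⟨h12.sub h3, ?_⟩
  rw [integral_sub h12 h3, integral_const_mul,
    integral_add h1 h2, integral_one_sub_cos_mul_rpow hH.1, integral_one_sub_cos_mul_rpow hH.1,
    integral_one_sub_cos_mul_rpow hH.1]
  simp only [SigmaH, ← hd]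
  ring

theorem quadForm_sigmaH_eq_integral {H : ℝ} (hH : H ∈ Set.Ioo (0 : ℝ) 1) (δ : ℝ) {N : ℕ}
    (x : Fin N → ℝ) :
    IntegrableOn (fun ξ : ℝ => (1 - Real.cos ξ) * ξ ^ (-1 - 2 * H) * periodogram x ξ)
      (Set.Ioi 0) ∧
    spectralConst H * (x ⬝ᵥ (SigmaH H δ N *ᵥ x)) = δ ^ (2 * H) * ∫ ξ in Set.Ioi (0 : ℝ),
      (1 - Real.cos ξ) * ξ ^ (-1 - 2 * H) * periodogram x ξ := by
  have heq : (fun ξ : ℝ => (1 - Real.cos ξ) * ξ ^ (-1 - 2 * H) * periodogram x ξ) =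
      fun ξ : ℝ => ∑ i, ∑ j, x i * x j * (Real.cos (((i : ℝ) - (j : ℝ)) * ξ) *
        ((1 - Real.cos ξ) * ξ ^ (-1 - 2 * H))) := by
    funext ξ
    simp only [periodogram, Finset.mul_sum]
    refine Finset.sum_congr rfl fun i _ => Finset.sum_congr rfl fun j _ => by ring
  have hint : ∀ i j : Fin N, IntegrableOn (fun ξ : ℝ => x i * x j *
      (Real.cos (((i : ℝ) - (j : ℝ)) * ξ) * ((1 - Real.cos ξ) * ξ ^ (-1 - 2 * H))))
      (Set.Ioi 0) := fun i j => (sigmaH_eq_integral hH δ i j).1.const_mul _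
  have hint' : ∀ i : Fin N, IntegrableOn (fun ξ : ℝ => ∑ j, x i * x j *
      (Real.cos (((i : ℝ) - (j : ℝ)) * ξ) * ((1 - Real.cos ξ) * ξ ^ (-1 - 2 * H))))
      (Set.Ioi 0) := fun i => integrable_finsetSum _ fun j _ => hint i j
  rw [heq]
  refine ⟨integrable_finsetSum _ fun i _ => hint' i, ?_⟩
  rw [integral_finsetSum _ fun i _ => hint' i]
  simp only [dotProduct, mulVec, Finset.mul_sum]
  refine Finset.sum_congr rfl fun i _ => ?_
  rw [integral_finsetSum _ fun j _ => hint i j, Finset.mul_sum]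
  refine Finset.sum_congr rfl fun j _ => ?_
  rw [integral_const_mul]
  linear_combination x i * x j * (sigmaH_eq_integral hH δ i j).2

theorem mul_integral_periodogram_le {H : ℝ} (hH : H ∈ Set.Ioo (0 : ℝ) 1) {N : ℕ}
    (x : Fin N → ℝ) {b m : ℝ} (hb : 0 ≤ b) (hbπ : b ≤ Real.pi)
    (hm : ∀ ξ ∈ Set.Ioc b Real.pi, m ≤ ξ ^ (1 - 2 * H)) :
    2 / Real.pi ^ 2 * m * ∫ ξ in b..Real.pi, periodogram x ξ ≤
      ∫ ξ in Set.Ioi (0 : ℝ), (1 - Real.cos ξ) * ξ ^ (-1 - 2 * H) * periodogram x ξ := by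
  have hint := (quadForm_sigmaH_eq_integral hH 1 x).1
  have hsub : Set.Ioc b Real.pi ⊆ Set.Ioi 0 := fun ξ hξ => lt_of_le_of_lt hb hξ.1
  rw [intervalIntegral.integral_of_le hbπ, ← integral_const_mul]
  calc ∫ ξ in Set.Ioc b Real.pi, 2 / Real.pi ^ 2 * m * periodogram x ξ
      ≤ ∫ ξ in Set.Ioc b Real.pi, (1 - Real.cos ξ) * ξ ^ (-1 - 2 * H) * periodogram x ξ := by
        refine setIntegral_mono_on ?_ (hint.mono_set hsub) measurableSet_Ioc fun ξ hξ => ?_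
        · exact ((continuous_periodogram x).const_mul _).integrableOn_Icc.mono_set
            Set.Ioc_subset_Icc_self
        · have hξ0 : 0 < ξ := hsub hξ
          refine mul_le_mul_of_nonneg_right ?_ (periodogram_nonneg x ξ)
          have hcos := Real.cos_le_one_sub_mul_cos_sq (x := ξ) (by
            rw [abs_of_pos hξ0]; exact hξ.2)
          have hpow : ξ ^ (1 - 2 * H) = ξ ^ 2 * ξ ^ (-1 - 2 * H) := by
            rw [← Real.rpow_natCast, ← Real.rpow_add hξ0]; norm_num; ring_nf
          have hw : 0 ≤ ξ ^ (-1 - 2 * H) := Real.rpow_nonneg hξ0.le _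
          calc 2 / Real.pi ^ 2 * m ≤ 2 / Real.pi ^ 2 * ξ ^ (1 - 2 * H) := by
                gcongr; exact hm ξ hξ
            _ = 2 / Real.pi ^ 2 * ξ ^ 2 * ξ ^ (-1 - 2 * H) := by rw [hpow]; ring
            _ ≤ (1 - Real.cos ξ) * ξ ^ (-1 - 2 * H) :=
                mul_le_mul_of_nonneg_right (by linarith) hw
    _ ≤ _ := by
        refine setIntegral_mono_set hint ?_ hsub.eventuallyLE
        filter_upwards [ae_restrict_mem measurableSet_Ioi] with ξ hξ
        exact mul_nonneg (mul_nonneg (by linarith [Real.cos_le_one ξ])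
          (Real.rpow_nonneg (le_of_lt hξ) _)) (periodogram_nonneg x ξ)

/-- Lower bound on the smallest eigenvalue of the covariance matrix of fractional Gaussian
noise. -/
theorem exists_le_quadForm_sigmaH {H : ℝ} (hH : H ∈ Set.Ioo (0 : ℝ) 1) :
    ∃ c > 0, ∀ (N : ℕ) (δ : ℝ) (x : Fin N → ℝ), 0 < N → 0 < δ →
      c * (δ ^ (2 * H) * (N : ℝ) ^ min 0 (2 * H - 1)) * ∑ i, x i ^ 2 ≤
        x ⬝ᵥ (SigmaH H δ N *ᵥ x) := by
  have hK := spectralConst_pos hH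
  have hπ := Real.pi_pos
  suffices h : ∃ c > 0, ∀ (N : ℕ) (x : Fin N → ℝ), 0 < N →
      c * (N : ℝ) ^ min 0 (2 * H - 1) * ∑ i, x i ^ 2 ≤
        ∫ ξ in Set.Ioi (0 : ℝ), (1 - Real.cos ξ) * ξ ^ (-1 - 2 * H) * periodogram x ξ by
    obtain ⟨c, hc, h⟩ := h
    refine ⟨c / spectralConst H, by positivity, fun N δ x hN hδ => ?_⟩
    refine le_of_mul_le_mul_left ?_ hK
    rw [(quadForm_sigmaH_eq_integral hH δ x).2]
    refine le_trans (le_of_eq ?_) (mul_le_mul_of_nonneg_left (h N x hN)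
      (Real.rpow_nonneg hδ.le (2 * H)))
    field_simp
  rcases le_total (1 / 2) H with hh | hh
  · refine ⟨2 / Real.pi ^ 2 * Real.pi ^ (1 - 2 * H) * Real.pi, by positivity, fun N x _ => ?_⟩
    have key := mul_integral_periodogram_le hH x le_rfl hπ.le (m := Real.pi ^ (1 - 2 * H))
      fun ξ hξ => Real.rpow_le_rpow_of_nonpos hξ.1 hξ.2 (by linarith)
    rw [integral_periodogram] at key
    rw [min_eq_left (by linarith), Real.rpow_zero]
    linarith
  · refine ⟨2 / Real.pi ^ 2 * (Real.pi / 2) ^ (1 - 2 * H) * (Real.pi / 2), by positivity,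
      fun N x hN => ?_⟩
    have hN' : (1 : ℝ) ≤ N := by exact_mod_cast hN
    set a : ℝ := Real.pi / 2 / N with ha
    have ha0 : 0 < a := by positivity
    have haN : a * N = Real.pi / 2 := by rw [ha]; field_simp
    have haπ : a ≤ Real.pi := by nlinarith
    have key := mul_integral_periodogram_le hH x ha0.le haπ (m := a ^ (1 - 2 * H))
      fun ξ hξ => Real.rpow_le_rpow ha0.le hξ.1.le (by linarith)
    have hci := fun u v => (continuous_periodogram x).intervalIntegrable (μ := volume) u v
    have hsplit := intervalIntegral.integral_add_adjacent_intervals (hci 0 a) (hci a Real.pi)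
    rw [integral_periodogram] at hsplit
    have hsmall : ∫ ξ in (0 : ℝ)..a, periodogram x ξ ≤ Real.pi / 2 * ∑ i, x i ^ 2 := by
      refine (intervalIntegral.integral_mono_on ha0.le (hci 0 a)
        (continuous_const.intervalIntegrable _ _) fun ξ _ => periodogram_le x ξ).trans_eq ?_
      rw [intervalIntegral.integral_const, smul_eq_mul, ← mul_assoc, sub_zero, haN]
    have hlarge : Real.pi / 2 * ∑ i, x i ^ 2 ≤ ∫ ξ in a..Real.pi, periodogram x ξ := by
      linarith
    rw [min_eq_right (by linarith)]
    refine le_trans (le_of_eq ?_) ((mul_le_mul_of_nonneg_left hlarge (by positivity)).trans key)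
    have hpow : a ^ (1 - 2 * H) = (Real.pi / 2) ^ (1 - 2 * H) * (N : ℝ) ^ (2 * H - 1) := by
      rw [ha, Real.div_rpow (by positivity) (by positivity), div_eq_mul_inv,
        ← Real.rpow_neg (by positivity)]
      ring_nf
    rw [hpow]
    ring

theorem dotProduct_inv_mulVec_mem_Icc {n : Type*} [Fintype n] [DecidableEq n]
    {A : Matrix n n ℝ} {l : ℝ} (hl : 0 < l) (hA : ∀ x, l * ∑ i, x i ^ 2 ≤ x ⬝ᵥ (A *ᵥ x))
    (y : n → ℝ) : y ⬝ᵥ (A⁻¹ *ᵥ y) ∈ Set.Icc 0 (l⁻¹ * ∑ i, y i ^ 2) := by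
  have hunit : IsUnit A := by
    rw [← Matrix.mulVec_injective_iff_isUnit]
    intro u v huv
    have h0 : A *ᵥ (u - v) = 0 := by rw [Matrix.mulVec_sub, sub_eq_zero]; exact huv
    have h1 := hA (u - v)
    rw [h0, dotProduct_zero] at h1
    have h2 : ∑ i, (u - v) i ^ 2 = 0 :=
      le_antisymm (by nlinarith) (Finset.sum_nonneg fun i _ => sq_nonneg _)
    funext i
    have := (Finset.sum_eq_zero_iff_of_nonneg fun i _ => sq_nonneg _).1 h2 i (Finset.mem_univ i)
    simpa [sub_eq_zero] using this
  set z := A⁻¹ *ᵥ y with hz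
  have hAz : A *ᵥ z = y := by
    rw [hz, Matrix.mulVec_mulVec,
      Matrix.mul_nonsing_inv _ ((Matrix.isUnit_iff_isUnit_det A).1 hunit), Matrix.one_mulVec]
  have h1 := hA z
  rw [hAz, dotProduct_comm] at h1
  have hz0 : 0 ≤ ∑ i, z i ^ 2 := Finset.sum_nonneg fun i _ => sq_nonneg _
  have hy0 : 0 ≤ ∑ i, y i ^ 2 := Finset.sum_nonneg fun i _ => sq_nonneg _
  have hcs : (y ⬝ᵥ z) ^ 2 ≤ (∑ i, y i ^ 2) * ∑ i, z i ^ 2 :=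
    Finset.sum_mul_sq_le_sq_mul_sq Finset.univ y z
  have hnn : 0 ≤ y ⬝ᵥ z := (mul_nonneg hl.le hz0).trans h1
  refine ⟨hnn, ?_⟩
  rw [inv_mul_eq_div, le_div_iff₀ hl]
  rcases hnn.eq_or_lt with h | h
  · rw [← h]; simpa using hy0
  · refine le_of_mul_le_mul_right ?_ h
    nlinarith

theorem sq_lintegral_le {α : Type*} [MeasurableSpace α] {μ : Measure α} {f : α → ENNReal}
    (hf : AEMeasurable f μ) : (∫⁻ a, f a ∂μ) ^ 2 ≤ μ Set.univ * ∫⁻ a, f a ^ 2 ∂μ := by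
  have h := ENNReal.lintegral_mul_le_Lp_mul_Lq μ Real.HolderConjugate.two_two hf
    (aemeasurable_const (b := (1 : ENNReal)))
  simp only [Pi.mul_apply, mul_one, ENNReal.one_rpow, lintegral_const, one_mul] at h
  have hsq : ∀ x : ENNReal, (x ^ (1 / 2 : ℝ)) ^ 2 = x := fun x => by
    rw [← ENNReal.rpow_natCast, ← ENNReal.rpow_mul]; norm_num
  calc (∫⁻ a, f a ∂μ) ^ 2 ≤ _ := pow_le_pow_left' h 2
    _ = μ Set.univ * ∫⁻ a, f a ^ 2 ∂μ := by
      rw [mul_pow, hsq, hsq, mul_comm]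
      simp

theorem sq_lintegral_mul_le {α : Type*} [MeasurableSpace α] {μ : Measure α}
    {w f : α → ENNReal} (hw : Measurable w) (hf : Measurable f) :
    (∫⁻ a, w a * f a ∂μ) ^ 2 ≤ (∫⁻ a, w a ∂μ) * ∫⁻ a, w a * f a ^ 2 ∂μ := by
  have h := sq_lintegral_le (μ := μ.withDensity w) hf.aemeasurable
  rwa [lintegral_withDensity_eq_lintegral_mul _ hw hf,
    lintegral_withDensity_eq_lintegral_mul _ hw (hf.pow_const 2),
    withDensity_apply _ MeasurableSet.univ, Measure.restrict_univ] at h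

/-- The density of the exponential kernel `s ↦ ε⁻¹ e^{-(t-s)/ε}` on `(-∞, t]`. -/
def expKernel (ε t s : ℝ) : ENNReal :=
  (Set.Iic t).indicator (fun s => ENNReal.ofReal (ε⁻¹ * Real.exp (-(t - s) / ε))) s

theorem measurable_expKernel (ε : ℝ) : Measurable fun p : ℝ × ℝ => expKernel ε p.1 p.2 := by
  have : (fun p : ℝ × ℝ => expKernel ε p.1 p.2) = {p : ℝ × ℝ | p.2 ≤ p.1}.indicator
      fun p => ENNReal.ofReal (ε⁻¹ * Real.exp (-(p.1 - p.2) / ε)) := by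
    funext p
    simp [expKernel, Set.indicator_apply]
  rw [this]
  exact Measurable.indicator (by fun_prop) (measurableSet_le measurable_snd measurable_fst)

theorem lintegral_expKernel_mul (ε t : ℝ) (f : ℝ → ENNReal) :
    ∫⁻ s, expKernel ε t s * f s =
      ∫⁻ s in Set.Iic t, ENNReal.ofReal (ε⁻¹ * Real.exp (-(t - s) / ε)) * f s := by
  rw [← lintegral_indicator measurableSet_Iic]
  refine lintegral_congr fun s => ?_
  simp only [expKernel, Set.indicator_apply]
  split_ifs <;> simp

theorem integrableOn_exp_neg_sub_div {ε : ℝ} (hε : 0 < ε) (t : ℝ) :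
    IntegrableOn (fun s => Real.exp (-(t - s) / ε)) (Set.Iic t) ∧
      ∫ s in Set.Iic t, Real.exp (-(t - s) / ε) = ε := by
  have heq : (fun s => Real.exp (-(t - s) / ε)) =
      fun s => Real.exp (-t / ε) * Real.exp (ε⁻¹ * s) := by
    funext s; rw [← Real.exp_add]; congr 1; field_simp; ring
  rw [heq]
  refine ⟨(integrableOn_exp_mul_Iic (inv_pos.2 hε) t).const_mul _, ?_⟩
  rw [integral_const_mul, integral_exp_mul_Iic (inv_pos.2 hε), ← mul_div_assoc, ← Real.exp_add]
  have : -t / ε + ε⁻¹ * t = 0 := by field_simp; ring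
  rw [this]; simp

theorem lintegral_exp_neg_sub_div {ε : ℝ} (hε : 0 < ε) (t : ℝ) :
    ∫⁻ s in Set.Iic t, ENNReal.ofReal (Real.exp (-(t - s) / ε)) = ENNReal.ofReal ε := by
  obtain ⟨h1, h2⟩ := integrableOn_exp_neg_sub_div hε t
  rw [← ofReal_integral_eq_lintegral_ofReal h1 (ae_of_all _ fun s => (Real.exp_pos _).le), h2]

theorem lintegral_expKernel {ε : ℝ} (hε : 0 < ε) (t : ℝ) : ∫⁻ s, expKernel ε t s = 1 := by
  have h := lintegral_expKernel_mul ε t 1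
  simp only [Pi.one_apply, mul_one] at h
  simp_rw [h, ENNReal.ofReal_mul (inv_pos.2 hε).le]
  rw [lintegral_const_mul _ (by fun_prop), lintegral_exp_neg_sub_div hε,
    ← ENNReal.ofReal_mul (inv_pos.2 hε).le, inv_mul_cancel₀ hε.ne', ENNReal.ofReal_one]

theorem rpow_le_nine_mul_exp_half {p r : ℝ} (hp : p ≤ 2) (hp0 : 0 ≤ p) (hr : 0 ≤ r) :
    r ^ p ≤ 9 * Real.exp (r / 2) := by
  have h1 : r ^ p ≤ 1 + r ^ 2 := by
    rcases le_total r 1 with h | h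
    · exact (Real.rpow_le_one hr h hp0).trans (by nlinarith)
    · have := Real.rpow_le_rpow_of_exponent_le h hp
      rw [Real.rpow_two] at this
      linarith
  have h2 := Real.quadratic_le_exp_of_nonneg (x := r / 2) (by positivity)
  nlinarith

theorem lintegral_expKernel_mul_rpow_le {ε H : ℝ} (hε : 0 < ε) (hH : H ∈ Set.Ioo (0 : ℝ) 1)
    (t : ℝ) : ∫⁻ s, expKernel ε t s * ENNReal.ofReal (|t - s| ^ (2 * H)) ≤
      ENNReal.ofReal (18 * ε ^ (2 * H)) := by
  rw [lintegral_expKernel_mul]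
  calc ∫⁻ s in Set.Iic t, ENNReal.ofReal (ε⁻¹ * Real.exp (-(t - s) / ε)) *
        ENNReal.ofReal (|t - s| ^ (2 * H))
      ≤ ∫⁻ s in Set.Iic t, ENNReal.ofReal (9 * ε ^ (2 * H) * ε⁻¹) *
          ENNReal.ofReal (Real.exp (-(t - s) / (2 * ε))) := by
        refine setLIntegral_mono (by fun_prop) fun s hs => ?_
        have hts : 0 ≤ t - s := sub_nonneg.2 hs
        rw [← ENNReal.ofReal_mul (by positivity), ← ENNReal.ofReal_mul (by positivity)]
        refine ENNReal.ofReal_le_ofReal ?_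
        have h := rpow_le_nine_mul_exp_half (p := 2 * H) (r := (t - s) / ε)
          (by linarith [hH.2]) (by linarith [hH.1]) (by positivity)
        rw [Real.div_rpow hts hε.le, div_le_iff₀ (by positivity)] at h
        have hexp : Real.exp (-(t - s) / (2 * ε)) =
            Real.exp (-(t - s) / ε) * Real.exp ((t - s) / ε / 2) := by
          rw [← Real.exp_add]; congr 1; field_simp; ring
        rw [abs_of_nonneg hts, hexp]
        calc ε⁻¹ * Real.exp (-(t - s) / ε) * (t - s) ^ (2 * H)
            ≤ ε⁻¹ * Real.exp (-(t - s) / ε) *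
              (9 * Real.exp ((t - s) / ε / 2) * ε ^ (2 * H)) := by gcongr
          _ = _ := by ring
    _ = ENNReal.ofReal (18 * ε ^ (2 * H)) := by
        rw [lintegral_const_mul _ (by fun_prop), lintegral_exp_neg_sub_div (by positivity),
          ← ENNReal.ofReal_mul (by positivity)]
        congr 1; field_simp; ring

section Paths

variable {Ω : Type*} [MeasureSpace Ω]

theorem continuous_fracOU {H σ ε : ℝ} (hε : 0 < ε) {B : ℝ → Ω → ℝ} {ω : Ω}
    (hcont : Continuous fun t => B t ω)
    (hint : ∀ t : ℝ, IntegrableOn (fun s => Real.exp (-(t - s) / ε) * B s ω) (Set.Iic t)) :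
    Continuous fun t => fracOU H σ ε B t ω := by
  have hrw : ∀ t s : ℝ, Real.exp (-(t - s) / ε) * B s ω =
      Real.exp (-t / ε) * (Real.exp (s / ε) * B s ω) := fun t s => by
    rw [← mul_assoc, ← Real.exp_add]; congr 2; field_simp; ring
  have hint' : ∀ t : ℝ, IntegrableOn (fun s => Real.exp (s / ε) * B s ω) (Set.Iic t) := by
    intro t
    have h := (hint t).const_mul (Real.exp (t / ε))
    refine h.congr (ae_of_all _ fun s => ?_)
    beta_reduce
    rw [← mul_assoc, ← Real.exp_add]; congr 2; field_simp; ring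
  have hprim : (fun t => ∫ s in Set.Iic t, Real.exp (s / ε) * B s ω) = fun t =>
      (∫ s in Set.Iic 0, Real.exp (s / ε) * B s ω) +
        ∫ s in (0 : ℝ)..t, Real.exp (s / ε) * B s ω := by
    funext t
    rw [← intervalIntegral.integral_Iic_sub_Iic (hint' 0) (hint' t)]
    ring
  have hc : Continuous fun t => ∫ s in Set.Iic t, Real.exp (s / ε) * B s ω := by
    rw [hprim]
    refine continuous_const.add (intervalIntegral.continuous_primitive (fun a b => ?_) 0)
    exact Continuous.intervalIntegrable (by fun_prop) _ _
  unfold fracOU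
  simp_rw [hrw, integral_const_mul]
  fun_prop

theorem enorm_fracOU_sq_le {H σ ε : ℝ} (hε : 0 < ε) (hσ : 0 < σ) {B : ℝ → Ω → ℝ} {ω : Ω}
    (hcont : Continuous fun t => B t ω) (t : ℝ)
    (hint : IntegrableOn (fun s => Real.exp (-(t - s) / ε) * B s ω) (Set.Iic t)) :
    ‖fracOU H σ ε B t ω‖ₑ ^ 2 ≤ ENNReal.ofReal ((σ / ε ^ H) ^ 2) *
      ∫⁻ s, expKernel ε t s * ‖B t ω - B s ω‖ₑ ^ 2 := by
  obtain ⟨he, he'⟩ := integrableOn_exp_neg_sub_div hε t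
  have hY : fracOU H σ ε B t ω = (σ / ε ^ H) *
      ∫ s in Set.Iic t, ε⁻¹ * Real.exp (-(t - s) / ε) * (B t ω - B s ω) := by
    have h1 : ∀ s, ε⁻¹ * Real.exp (-(t - s) / ε) * (B t ω - B s ω) =
        ε⁻¹ * (Real.exp (-(t - s) / ε) * B t ω - Real.exp (-(t - s) / ε) * B s ω) :=
      fun s => by ring
    simp_rw [fracOU, h1]
    rw [integral_const_mul, integral_sub (he.mul_const _) hint, integral_mul_const, he']
    field_simp
  have hle : ‖fracOU H σ ε B t ω‖ₑ ≤ ENNReal.ofReal (σ / ε ^ H) *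
      ∫⁻ s, expKernel ε t s * ‖B t ω - B s ω‖ₑ := by
    rw [hY, enorm_mul, Real.enorm_of_nonneg (by positivity), lintegral_expKernel_mul]
    gcongr
    refine (enorm_integral_le_lintegral_enorm _).trans_eq (lintegral_congr fun s => ?_)
    rw [enorm_mul, Real.enorm_of_nonneg (by positivity)]
  have hm : Measurable fun s => B s ω := hcont.measurable
  calc ‖fracOU H σ ε B t ω‖ₑ ^ 2 ≤ _ := pow_le_pow_left' hle 2
    _ ≤ ENNReal.ofReal ((σ / ε ^ H) ^ 2) *
        ((∫⁻ s, expKernel ε t s) * ∫⁻ s, expKernel ε t s * ‖B t ω - B s ω‖ₑ ^ 2) := by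
      rw [mul_pow, ENNReal.ofReal_pow (by positivity)]
      gcongr
      exact sq_lintegral_mul_le ((measurable_expKernel ε).comp measurable_prodMk_left)
        (by fun_prop)
    _ = _ := by rw [lintegral_expKernel hε, one_mul]

theorem enorm_incVec_sq_le {H σ ε δ : ℝ} (hε : 0 < ε) (hσ : 0 < σ) (hδ : 0 < δ)
    {B : ℝ → Ω → ℝ} {ω : Ω} (hcont : Continuous fun t => B t ω)
    (hint : ∀ t : ℝ, IntegrableOn (fun s => Real.exp (-(t - s) / ε) * B s ω) (Set.Iic t))
    {N : ℕ} (k : Fin N) :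
    ‖incVec H σ ε δ B N ω k‖ₑ ^ 2 ≤
      ENNReal.ofReal ((ε ^ (H - 1)) ^ 2 * δ * (σ / ε ^ H) ^ 2) *
        ∫⁻ t in Set.Ioc ((k : ℕ) * δ) (((k : ℕ) + 1 : ℝ) * δ),
          ∫⁻ s, expKernel ε t s * ‖B t ω - B s ω‖ₑ ^ 2 := by
  have hY := continuous_fracOU (H := H) (σ := σ) hε hcont hint
  have hle : ((k : ℕ) * δ : ℝ) ≤ ((k : ℕ) + 1 : ℝ) * δ := by nlinarith
  have hV : incVec H σ ε δ B N ω k = ε ^ (H - 1) *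
      ∫ t in Set.Ioc ((k : ℕ) * δ) (((k : ℕ) + 1 : ℝ) * δ), fracOU H σ ε B t ω := by
    rw [← intervalIntegral.integral_of_le hle, incVec, slowX, slowX, ← mul_sub,
      intervalIntegral.integral_interval_sub_left (hY.intervalIntegrable _ _)
        (hY.intervalIntegrable _ _)]
  rw [hV, enorm_mul, mul_pow, Real.enorm_of_nonneg (by positivity),
    ← ENNReal.ofReal_pow (by positivity), ENNReal.ofReal_mul (by positivity),
    ENNReal.ofReal_mul (by positivity), mul_assoc, mul_assoc]
  gcongr
  calc _ ≤ (∫⁻ t in Set.Ioc ((k : ℕ) * δ) (((k : ℕ) + 1 : ℝ) * δ),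
          ‖fracOU H σ ε B t ω‖ₑ) ^ 2 :=
        pow_le_pow_left' (enorm_integral_le_lintegral_enorm _) 2
    _ ≤ _ := sq_lintegral_le hY.measurable.enorm.aemeasurable
    _ = ENNReal.ofReal δ * ∫⁻ t in Set.Ioc ((k : ℕ) * δ) (((k : ℕ) + 1 : ℝ) * δ),
          ‖fracOU H σ ε B t ω‖ₑ ^ 2 := by
        rw [Measure.restrict_apply_univ, Real.volume_Ioc]; congr 2; ring
    _ ≤ ENNReal.ofReal δ * ∫⁻ t in Set.Ioc ((k : ℕ) * δ) (((k : ℕ) + 1 : ℝ) * δ),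
          ENNReal.ofReal ((σ / ε ^ H) ^ 2) *
            ∫⁻ s, expKernel ε t s * ‖B t ω - B s ω‖ₑ ^ 2 := by
        gcongr with t
        exact enorm_fracOU_sq_le hε hσ hcont t (hint t)
    _ = _ := by rw [lintegral_const_mul' _ _ ENNReal.ofReal_ne_top]

end Paths

section Moments

variable {Ω : Type*} [MeasureSpace Ω]

theorem IsTwoSidedFBM.lintegral_enorm_sub_sq {H : ℝ} (hH : 0 < H) {B : ℝ → Ω → ℝ}
    (hB : IsTwoSidedFBM H B) (t s : ℝ) :
    ∫⁻ ω, ‖B t ω - B s ω‖ₑ ^ 2 = ENNReal.ofReal (|t - s| ^ (2 * H)) := by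
  have h := hB.gaussian 2 ![t, s] ![1, -1]
  have hv : (∑ i, ∑ j, (![1, -1] : Fin 2 → ℝ) i * (![1, -1] : Fin 2 → ℝ) j *
      fbmCov H ((![t, s] : Fin 2 → ℝ) i) ((![t, s] : Fin 2 → ℝ) j)) = |t - s| ^ (2 * H) := by
    have h0 : (0 : ℝ) ^ (2 * H) = 0 := Real.zero_rpow (by positivity)
    simp only [Fin.sum_univ_two, fbmCov, Matrix.cons_val_zero, Matrix.cons_val_one, sub_self,
      abs_zero, h0, abs_sub_comm s t]
    ring
  rw [hv] at h
  simp only [Fin.sum_univ_two, Matrix.cons_val_zero, Matrix.cons_val_one, one_mul, neg_mul,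
    ← sub_eq_add_neg] at h
  have hm : Measurable fun ω => B t ω - B s ω := (hB.meas t).sub (hB.meas s)
  have hmap := lintegral_map (μ := (ℙ : Measure Ω)) (f := fun x : ℝ => ‖x‖ₑ ^ 2)
    (by fun_prop) hm
  rw [← hmap, h]
  have hvar := ofReal_variance (memLp_id_gaussianReal' (μ := 0)
    (v := (|t - s| ^ (2 * H)).toNNReal) 2 (by simp))
  rw [variance_id_gaussianReal, evariance] at hvar
  simp only [id, integral_id_gaussianReal, sub_zero] at hvar
  rw [← hvar, Real.coe_toNNReal _ (by positivity)]

theorem IsTwoSidedFBM.exists_continuous_modification {H : ℝ} {B : ℝ → Ω → ℝ}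
    (hB : IsTwoSidedFBM H B) : ∃ B' : ℝ → Ω → ℝ,
      (Measurable fun p : ℝ × Ω => B' p.1 p.2) ∧ ∀ᵐ ω : Ω, ∀ t, B' t ω = B t ω := by
  set A : Set Ω := toMeasurable ℙ {ω | ¬ Continuous fun t => B t ω}
  have hA : (ℙ : Measure Ω) A = 0 := by rw [measure_toMeasurable]; exact hB.cont
  refine ⟨fun t => Aᶜ.indicator (B t), ?_, ?_⟩
  · refine (measurable_uncurry_of_continuous_of_measurable
      (u := fun (t : ℝ) => Aᶜ.indicator (B t)) (fun ω => ?_) fun t =>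
        (hB.meas t).indicator (measurableSet_toMeasurable _ _).compl)
    by_cases hω : ω ∈ A
    · simp [Set.indicator_of_notMem (show ω ∉ Aᶜ from fun h => h hω), continuous_const]
    · have hc : Continuous fun t => B t ω := by
        by_contra hc
        exact hω (subset_toMeasurable _ _ hc)
      simpa [Set.indicator_of_mem (show ω ∈ Aᶜ from hω)] using hc
  · filter_upwards [compl_mem_ae_iff.2 hA] with ω hω t
    exact Set.indicator_of_mem hω _

theorem lintegral_enorm_sigmaHat2_le [IsProbabilityMeasure (ℙ : Measure Ω)] {H σ ε δ l : ℝ}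
    (hH : H ∈ Set.Ioo (0 : ℝ) 1) (hε : 0 < ε) (hσ : 0 < σ) (hδ : 0 < δ) (hl : 0 < l)
    {B : ℝ → Ω → ℝ} (hB : IsTwoSidedFBM H B)
    (hint : ∀ᵐ ω : Ω, ∀ t : ℝ,
      IntegrableOn (fun s => Real.exp (-(t - s) / ε) * |B s ω|) (Set.Iic t))
    {N : ℕ} (hN : 0 < N)
    (hA : ∀ x : Fin N → ℝ, l * ∑ i, x i ^ 2 ≤ x ⬝ᵥ (SigmaH H δ N *ᵥ x)) :
    ∫⁻ ω, ‖sigmaHat2 H σ ε δ B N ω‖ₑ ≤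
      ENNReal.ofReal (l⁻¹ * (18 * σ ^ 2 * (ε ^ (H - 1)) ^ 2 * δ ^ 2)) := by
  obtain ⟨B', hB'm, hB'⟩ := hB.exists_continuous_modification
  have hN' : (0 : ℝ) < N := by exact_mod_cast hN
  set c : ℝ := (ε ^ (H - 1)) ^ 2 * δ * (σ / ε ^ H) ^ 2 with hc
  have hc0 : 0 ≤ c := by positivity
  have hF : Measurable fun p : (Ω × ℝ) × ℝ =>
      expKernel ε p.1.2 p.2 * ‖B' p.1.2 p.1.1 - B' p.2 p.1.1‖ₑ ^ 2 := by
    have h1 : Measurable fun p : (Ω × ℝ) × ℝ => expKernel ε p.1.2 p.2 :=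
      (measurable_expKernel ε).comp (measurable_fst.snd.prodMk measurable_snd)
    have h2 : Measurable fun p : (Ω × ℝ) × ℝ => B' p.1.2 p.1.1 :=
      hB'm.comp (measurable_fst.snd.prodMk measurable_fst.fst)
    have h3 : Measurable fun p : (Ω × ℝ) × ℝ => B' p.2 p.1.1 :=
      hB'm.comp (measurable_snd.prodMk measurable_fst.fst)
    exact h1.mul ((h2.sub h3).enorm.pow_const 2)
  set F : Ω → ℝ → ENNReal := fun ω t =>
    ∫⁻ s, expKernel ε t s * ‖B' t ω - B' s ω‖ₑ ^ 2 with hFdef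
  have hFm : Measurable fun p : Ω × ℝ => F p.1 p.2 := hF.lintegral_prod_right'
  have hFt : ∀ t, ∫⁻ ω, F ω t ≤ ENNReal.ofReal (18 * ε ^ (2 * H)) := by
    intro t
    have hm : Measurable fun p : Ω × ℝ => expKernel ε t p.2 * ‖B' t p.1 - B' p.2 p.1‖ₑ ^ 2 :=
      hF.comp ((measurable_fst.prodMk measurable_const).prodMk measurable_snd)
    rw [hFdef, lintegral_lintegral_swap hm.aemeasurable]
    refine le_trans (le_of_eq (lintegral_congr fun s => ?_))
      (lintegral_expKernel_mul_rpow_le hε hH t)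
    rw [lintegral_const_mul, ← hB.lintegral_enorm_sub_sq hH.1]
    · congr 1
      refine lintegral_congr_ae ?_
      filter_upwards [hB'] with ω hω
      rw [hω, hω]
    · have h2 : Measurable fun ω => B' t ω := hB'm.comp measurable_prodMk_left
      have h3 : Measurable fun ω => B' s ω := hB'm.comp measurable_prodMk_left
      fun_prop
  have hG : ∀ a b : ℝ, ∫⁻ ω, ∫⁻ t in Set.Ioc a b, F ω t ≤
      ENNReal.ofReal (18 * ε ^ (2 * H)) * ENNReal.ofReal (b - a) := by
    intro a b
    rw [lintegral_lintegral_swap hFm.aemeasurable]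
    calc _ ≤ ∫⁻ t in Set.Ioc a b, ENNReal.ofReal (18 * ε ^ (2 * H)) := lintegral_mono hFt
      _ = _ := by simp
  have hpoint : ∀ᵐ ω : Ω, ‖sigmaHat2 H σ ε δ B N ω‖ₑ ≤
      ENNReal.ofReal (1 / N * l⁻¹) * ∑ k : Fin N, ENNReal.ofReal c *
        ∫⁻ t in Set.Ioc ((k : ℕ) * δ) (((k : ℕ) + 1 : ℝ) * δ), F ω t := by
    filter_upwards [hB.cont, hB', hint] with ω hcont hω hi
    have hi' : ∀ t : ℝ, IntegrableOn (fun s => Real.exp (-(t - s) / ε) * B s ω) (Set.Iic t) :=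
      fun t => Integrable.mono (hi t)
        (Continuous.aestronglyMeasurable (by fun_prop)) (ae_of_all _ fun s => by simp)
    obtain ⟨h0, h1⟩ := dotProduct_inv_mulVec_mem_Icc hl hA (incVec H σ ε δ B N ω)
    rw [sigmaHat2, Real.enorm_of_nonneg (by positivity)]
    calc _ ≤ ENNReal.ofReal (1 / N * (l⁻¹ * ∑ k, incVec H σ ε δ B N ω k ^ 2)) := by gcongr
      _ = ENNReal.ofReal (1 / N * l⁻¹) * ∑ k, ‖incVec H σ ε δ B N ω k‖ₑ ^ 2 := by
        rw [← mul_assoc, ENNReal.ofReal_mul (by positivity),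
          ENNReal.ofReal_sum_of_nonneg fun k _ => sq_nonneg _]
        congr 1
        refine Finset.sum_congr rfl fun k _ => ?_
        rw [← sq_abs, ENNReal.ofReal_pow (abs_nonneg _), Real.enorm_eq_ofReal_abs]
      _ ≤ _ := by
        gcongr with k
        have h := enorm_incVec_sq_le (H := H) hε hσ hδ hcont hi' k
        simpa only [hFdef, hω] using h
  calc ∫⁻ ω, ‖sigmaHat2 H σ ε δ B N ω‖ₑ ≤ _ := lintegral_mono_ae hpoint
    _ = ENNReal.ofReal (1 / N * l⁻¹) * ∑ k : Fin N, ENNReal.ofReal c *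
        ∫⁻ ω, ∫⁻ t in Set.Ioc ((k : ℕ) * δ) (((k : ℕ) + 1 : ℝ) * δ), F ω t := by
      rw [lintegral_const_mul' _ _ ENNReal.ofReal_ne_top, lintegral_finsetSum]
      · simp_rw [lintegral_const_mul' _ _ ENNReal.ofReal_ne_top]
      · intro k _
        exact (hFm.lintegral_prod_right' (ν := volume.restrict _)).const_mul _
    _ ≤ ENNReal.ofReal (1 / N * l⁻¹) * ∑ k : Fin N, ENNReal.ofReal c *
        (ENNReal.ofReal (18 * ε ^ (2 * H)) * ENNReal.ofReal δ) := by
      gcongr with k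
      refine (hG _ _).trans_eq ?_
      congr 2
      ring
    _ = ENNReal.ofReal (l⁻¹ * (18 * σ ^ 2 * (ε ^ (H - 1)) ^ 2 * δ ^ 2)) := by
      rw [Finset.sum_const, Finset.card_univ, Fintype.card_fin, nsmul_eq_mul,
        ← ENNReal.ofReal_natCast N, ← ENNReal.ofReal_mul (by positivity),
        ← ENNReal.ofReal_mul hc0, ← ENNReal.ofReal_mul hN'.le,
        ← ENNReal.ofReal_mul (by positivity)]
      congr 1
      have hpow : ε ^ (2 * H) = (ε ^ H) ^ 2 := by
        rw [mul_comm, Real.rpow_mul hε.le, Real.rpow_two]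
      have hp : 0 < ε ^ H := Real.rpow_pos_of_pos hε H
      rw [hc, hpow]
      field_simp

end Moments

/-- Asymptotic bias under too-fast sampling: if `δ = ε^α` with
`α > max{1, 2(1−H)}`, then `E[σ̂²_{ε,ε^α}] → 0` as `ε → 0⁺`. -/
theorem sigmaHat2_bias_fast_sampling
    {Ω : Type*} [MeasureSpace Ω] [IsProbabilityMeasure (ℙ : Measure Ω)]
    (H σ T α : ℝ) (hH : H ∈ Set.Ioo (0 : ℝ) 1) (hσ : 0 < σ) (hT : 0 < T)
    (hα : max 1 (2 * (1 - H)) < α)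
    (B : ℝ → Ω → ℝ) (hB : IsTwoSidedFBM H B)
    (hInt : ∀ ε : ℝ, 0 < ε → ∀ᵐ ω : Ω, ∀ t : ℝ,
      IntegrableOn (fun s => Real.exp (-(t - s) / ε) * |B s ω|) (Set.Iic t))
    (εs : ℕ → ℝ) (Ns : ℕ → ℕ)
    (hεpos : ∀ n, 0 < εs n) (hε0 : Tendsto εs atTop (𝓝 0))
    (hNpos : ∀ n, 0 < Ns n) (hNs : ∀ n, (Ns n : ℝ) = T / (εs n) ^ α) :
    Tendsto (fun n => ∫ ω, sigmaHat2 H σ (εs n) ((εs n) ^ α) B (Ns n) ω)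
      atTop (𝓝 0) := by
  have hH' := hH
  obtain ⟨hH0, hH1⟩ := hH'
  obtain ⟨hα1, hα2⟩ := max_lt_iff.1 hα
  obtain ⟨c, hc, hquad⟩ := exists_le_quadForm_sigmaH hH
  set m : ℝ := min 0 (2 * H - 1) with hm
  set β : ℝ := (2 - 2 * H) * (α - 1) + m * α with hβ
  have hβ0 : 0 < β := by
    rcases min_cases 0 (2 * H - 1) with ⟨h, _⟩ | ⟨h, _⟩
    · rw [hβ, hm, h]
      nlinarith
    · rw [hβ, hm, h]
      linarith
  have hbound : ∀ n, ‖∫ ω, sigmaHat2 H σ (εs n) ((εs n) ^ α) B (Ns n) ω‖ ≤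
      c⁻¹ * T ^ (-m) * (18 * σ ^ 2) * εs n ^ β := by
    intro n
    have hε := hεpos n
    have hδ : 0 < εs n ^ α := Real.rpow_pos_of_pos hε α
    have hN : (0 : ℝ) < Ns n := by exact_mod_cast hNpos n
    have h := (enorm_integral_le_lintegral_enorm _).trans
      (lintegral_enorm_sigmaHat2_le hH hε hσ hδ
        (l := c * ((εs n ^ α) ^ (2 * H) * (Ns n : ℝ) ^ m)) (by positivity) hB (hInt _ hε)
        (hNpos n) fun x => hquad (Ns n) _ x (hNpos n) hδ)
    rw [← ofReal_norm, ENNReal.ofReal_le_ofReal_iff (by positivity)] at h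
    refine h.trans_eq ?_
    have hβ' : εs n ^ β = (εs n ^ (H - 1)) ^ 2 * (εs n ^ α) ^ 2 *
        ((εs n ^ α) ^ (2 * H))⁻¹ * (εs n ^ α) ^ m := by
      rw [← Real.rpow_natCast, ← Real.rpow_natCast, ← Real.rpow_mul hε.le,
        ← Real.rpow_mul hε.le, ← Real.rpow_mul hε.le, ← Real.rpow_mul hε.le,
        ← Real.rpow_neg hε.le, ← Real.rpow_add hε, ← Real.rpow_add hε, ← Real.rpow_add hε]
      congr 1
      rw [hβ]
      push_cast
      ring
    rw [hβ', hNs n, Real.div_rpow hT.le hδ.le, Real.rpow_neg hT.le]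
    have h1 : 0 < T ^ m := Real.rpow_pos_of_pos hT m
    have h2 : 0 < (εs n ^ α) ^ m := Real.rpow_pos_of_pos hδ m
    have h3 : 0 < (εs n ^ α) ^ (2 * H) := Real.rpow_pos_of_pos hδ _
    field_simp
  refine squeeze_zero_norm hbound ?_
  have hlim : Tendsto (fun n => εs n ^ β) atTop (𝓝 0) := by
    have := hε0.rpow_const (p := β) (Or.inr hβ0.le)
    rwa [Real.zero_rpow hβ0.ne'] at this
  simpa using hlim.const_mul (c⁻¹ * T ^ (-m) * (18 * σ ^ 2))
end
end

section
/- Let H ∈ (1/2,1), set γ = H − 1/2, and let T > 0. For every step function f on [0,T) (i.e. f = Σ_{i=0}^{N−1} u_{i+1} 1_{[iδ,(i+1)δ)} with δ = T/N and u ∈ ℝ^N), the following inequality holds: ∫_ℝ f(t)² dt ≤ ( ∫_ℝ (I_+^γ f(t))² dt )^{1/2} · ( ∫_0^T (D_−^γ f(t))² dt )^{1/2}. -/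
open MeasureTheory Filter Topology

noncomputable section

/-- Fractional integral `I_+^γ h(t) = (1/Γ(γ)) ∫_{−∞}^t (t−s)^{γ−1} h(s) ds`. -/
def fracIntPlus (γ : ℝ) (h : ℝ → ℝ) (t : ℝ) : ℝ :=
  (1 / Real.Gamma γ) * ∫ s in Set.Iio t, (t - s) ^ (γ - 1) * h s

/-- Marchaud fractional derivative
`D_−^γ h(t) = (γ/Γ(1−γ)) ∫_0^∞ (h(t) − h(t+s)) s^{−γ−1} ds`. -/
def marchaudDMinus (γ : ℝ) (h : ℝ → ℝ) (t : ℝ) : ℝ :=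
  (γ / Real.Gamma (1 - γ)) * ∫ s in Set.Ioi (0 : ℝ), (h t - h (t + s)) * s ^ (-γ - 1)

/-- The step function `f = Σ_{i=0}^{N−1} u_{i+1} 1_{[iδ,(i+1)δ)}` with `δ = T/N`. -/
def stepFun (T : ℝ) (N : ℕ) (u : Fin N → ℝ) (t : ℝ) : ℝ :=
  ∑ i : Fin N, (Set.Ico ((i : ℝ) * (T / N)) (((i : ℝ) + 1) * (T / N))).indicator
    (fun _ => u i) t

/-- Real Beta integral over `[0, c]`. -/
theorem integral_rpow_mul_sub_rpow {p q c : ℝ} (hp : 0 < p) (hq : 0 < q) (hc : 0 < c) :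
    ∫ x in (0 : ℝ)..c, x ^ (p - 1) * (c - x) ^ (q - 1)
      = c ^ (p + q - 1) * ProbabilityTheory.beta p q := by
  have h := Complex.betaIntegral_scaled (p : ℂ) (q : ℂ) hc
  rw [Complex.betaIntegral_eq_Gamma_mul_div _ _ (by simpa) (by simpa)] at h
  have hl : ∫ x in (0 : ℝ)..c, (x : ℂ) ^ ((p : ℂ) - 1) * ((c : ℂ) - x) ^ ((q : ℂ) - 1)
      = ((∫ x in (0 : ℝ)..c, x ^ (p - 1) * (c - x) ^ (q - 1) : ℝ) : ℂ) := by
    rw [← intervalIntegral.integral_ofReal]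
    refine intervalIntegral.integral_congr fun x hx => ?_
    rw [Set.uIcc_of_le hc.le] at hx
    simp only [Complex.ofReal_mul]
    rw [Complex.ofReal_cpow hx.1, Complex.ofReal_cpow (sub_nonneg.2 hx.2)]
    push_cast
    rfl
  rw [hl, ← Complex.ofReal_add, Complex.Gamma_ofReal, Complex.Gamma_ofReal, Complex.Gamma_ofReal,
    ← Complex.ofReal_one, ← Complex.ofReal_sub, ← Complex.ofReal_cpow hc.le] at h
  rw [ProbabilityTheory.beta]
  exact_mod_cast h

theorem integral_sub_rpow_mul_sub_rpow_neg {γ a b : ℝ} (h0 : 0 < γ) (h1 : γ < 1) (hab : a < b) :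
    ∫ x in a..b, (x - a) ^ γ * (b - x) ^ (-γ)
      = (b - a) * (Real.Gamma (γ + 1) * Real.Gamma (1 - γ)) := by
  have h := integral_rpow_mul_sub_rpow (p := γ + 1) (q := 1 - γ) (by linarith) (by linarith)
    (sub_pos.2 hab)
  rw [ProbabilityTheory.beta, show γ + 1 + (1 - γ) = 2 by ring, Real.Gamma_two] at h
  norm_num at h
  rw [← h]
  have := intervalIntegral.integral_comp_sub_right (a := a) (b := b)
    (fun x => x ^ γ * (b - a - x) ^ (-γ)) a
  simp only [sub_self] at this
  rw [← this]
  refine intervalIntegral.integral_congr fun x _ => ?_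
  simp

theorem setIntegral_max_rpow_mul_max_rpow_neg {γ a b T : ℝ} (h0 : 0 < γ) (h1 : γ < 1)
    (ha : 0 ≤ a) (hb : b ≤ T) :
    ∫ t in Set.Icc 0 T, max (t - a) 0 ^ γ * max (b - t) 0 ^ (-γ)
      = max (b - a) 0 * (Real.Gamma (γ + 1) * Real.Gamma (1 - γ)) := by
  have hγ : -γ ≠ 0 := by linarith
  have hz : ∀ t, t ∉ Set.Ioc a b → max (t - a) 0 ^ γ * max (b - t) 0 ^ (-γ) = 0 := by
    intro t ht
    by_cases hta : a < t
    · have : b - t ≤ 0 := by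
        by_contra! h
        exact ht ⟨hta, by linarith⟩
      rw [max_eq_right this, Real.zero_rpow hγ, mul_zero]
    · rw [max_eq_right (by linarith : t - a ≤ 0), Real.zero_rpow h0.ne', zero_mul]
  have hsub : Set.Ioc a b ⊆ Set.Icc 0 T := fun t ht => ⟨ha.trans ht.1.le, ht.2.trans hb⟩
  rw [setIntegral_eq_of_subset_of_forall_sdiff_eq_zero measurableSet_Icc hsub
    fun t ht => hz t ht.2]
  rcases lt_or_ge a b with hab | hab
  · rw [max_eq_left (sub_pos.2 hab).le, ← integral_sub_rpow_mul_sub_rpow_neg h0 h1 hab,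
      intervalIntegral.integral_of_le hab.le]
    refine setIntegral_congr_fun measurableSet_Ioc fun t ht => ?_
    simp only [max_eq_left (sub_nonneg.2 ht.1.le), max_eq_left (sub_nonneg.2 ht.2)]
  · rw [Set.Ioc_eq_empty (not_lt.2 hab), max_eq_right (by linarith)]
    simp

theorem setIntegral_indicator_Ici_mul_indicator_Iio {a b T : ℝ} (ha : 0 ≤ a) (hb : b ≤ T) :
    ∫ t in Set.Icc 0 T, (Set.Ici a).indicator (1 : ℝ → ℝ) t * (Set.Iio b).indicator 1 t
      = max (b - a) 0 := by
  have hsub : Set.Ico a b ⊆ Set.Icc 0 T := fun t ht => ⟨ha.trans ht.1, ht.2.le.trans hb⟩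
  have h : ∀ t, (Set.Ici a).indicator (1 : ℝ → ℝ) t * (Set.Iio b).indicator 1 t
      = (Set.Ico a b).indicator 1 t := fun t => by
    rw [← Set.Ici_inter_Iio, Set.inter_indicator_one, Pi.mul_apply]
  simp_rw [h]
  rw [setIntegral_indicator measurableSet_Ico, Set.inter_eq_right.2 hsub]
  simp [Measure.real, ENNReal.toReal_ofReal']

/-- Bilinear expansion of the integral of a product of two combinations of differences. -/
theorem integral_sum_sub_mul_sum_sub {α ι : Type*} [MeasurableSpace α] [Fintype ι]
    {μ : Measure α} {φ ψ : ℝ → α → ℝ} {s : Set ℝ} {m : ℝ → ℝ → ℝ} {a b : ι → ℝ} (u : ι → ℝ)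
    (ha : ∀ i, a i ∈ s) (hb : ∀ i, b i ∈ s)
    (hint : ∀ x ∈ s, ∀ y ∈ s, Integrable (fun t => φ x t * ψ y t) μ)
    (hm : ∀ x ∈ s, ∀ y ∈ s, ∫ t, φ x t * ψ y t ∂μ = m x y) :
    ∫ t, (∑ i, u i * (φ (a i) t - φ (b i) t)) * (∑ j, u j * (ψ (b j) t - ψ (a j) t)) ∂μ
      = ∑ i, ∑ j, u i * u j *
          (m (a i) (b j) - m (a i) (a j) - (m (b i) (b j) - m (b i) (a j))) := by
  have hi : ∀ i j, Integrable (fun t => u i * u j *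
      (φ (a i) t * ψ (b j) t - φ (a i) t * ψ (a j) t
        - (φ (b i) t * ψ (b j) t - φ (b i) t * ψ (a j) t))) μ := fun i j =>
    (((hint _ (ha i) _ (hb j)).sub (hint _ (ha i) _ (ha j))).sub
      ((hint _ (hb i) _ (hb j)).sub (hint _ (hb i) _ (ha j)))).const_mul _
  have hexp : ∀ t, (∑ i, u i * (φ (a i) t - φ (b i) t)) * (∑ j, u j * (ψ (b j) t - ψ (a j) t))
      = ∑ i, ∑ j, u i * u j * (φ (a i) t * ψ (b j) t - φ (a i) t * ψ (a j) t
        - (φ (b i) t * ψ (b j) t - φ (b i) t * ψ (a j) t)) := fun t => by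
    rw [Finset.sum_mul_sum]
    refine Finset.sum_congr rfl fun i _ => Finset.sum_congr rfl fun j _ => ?_
    ring
  simp_rw [hexp]
  rw [integral_finsetSum _ fun i _ => integrable_finsetSum _ fun j _ => hi i j]
  refine Finset.sum_congr rfl fun i _ => ?_
  rw [integral_finsetSum _ fun j _ => hi i j]
  refine Finset.sum_congr rfl fun j _ => ?_
  rw [integral_const_mul, integral_sub, integral_sub, integral_sub, hm _ (ha i) _ (hb j),
    hm _ (ha i) _ (ha j), hm _ (hb i) _ (hb j), hm _ (hb i) _ (ha j)]
  exacts [hint _ (hb i) _ (hb j), hint _ (hb i) _ (ha j), hint _ (ha i) _ (hb j),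
    hint _ (ha i) _ (ha j), (hint _ (ha i) _ (hb j)).sub (hint _ (ha i) _ (ha j)),
    (hint _ (hb i) _ (hb j)).sub (hint _ (hb i) _ (ha j))]

/-- Cauchy–Schwarz inequality for the Bochner integral of real functions. -/
theorem integral_mul_le_sqrt_mul_sqrt {α : Type*} [MeasurableSpace α] {μ : Measure α}
    {f g : α → ℝ} (hf : MemLp f 2 μ) (hg : MemLp g 2 μ) :
    ∫ t, f t * g t ∂μ ≤ √(∫ t, f t ^ 2 ∂μ) * √(∫ t, g t ^ 2 ∂μ) := by
  have h := integral_mul_norm_le_Lp_mul_Lq (μ := μ) (f := f) (g := g) Real.HolderConjugate.two_two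
    (by simpa using hf) (by simpa using hg)
  simp only [Real.norm_eq_abs, Real.rpow_two, sq_abs, ← Real.sqrt_eq_rpow] at h
  refine le_trans (integral_mono (hf.integrable_mul hg) ((hf.integrable_mul hg).abs) ?_) ?_
  · exact fun t => le_abs_self _
  · simpa [abs_mul] using h

theorem hasIntegral_fracInt_indicator_Ici {γ : ℝ} (h0 : 0 < γ) (a t : ℝ) :
    IntegrableOn (fun s => (t - s) ^ (γ - 1) * (Set.Ici a).indicator 1 s) (Set.Iio t) ∧
      ∫ s in Set.Iio t, (t - s) ^ (γ - 1) * (Set.Ici a).indicator 1 s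
        = max (t - a) 0 ^ γ / γ := by
  have heq : (fun s => (t - s) ^ (γ - 1) * (Set.Ici a).indicator (1 : ℝ → ℝ) s)
      = (Set.Ici a).indicator (fun s => (t - s) ^ (γ - 1)) := by
    ext s
    by_cases hs : s ∈ Set.Ici a <;> simp [hs]
  have hint : IntervalIntegrable (fun s => (t - s) ^ (γ - 1)) volume a t := by
    simpa using ((intervalIntegral.intervalIntegrable_rpow' (a := 0) (b := t - a)
      (by linarith : -1 < γ - 1)).comp_sub_left t).symm
  rw [heq]
  constructor
  · rw [integrableOn_indicator_iff measurableSet_Ici, Set.Ici_inter_Iio]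
    rcases le_total a t with h | h
    · exact ((intervalIntegrable_iff_integrableOn_Ioo_of_le h).1 hint).congr_set_ae Ioo_ae_eq_Ico.symm
    · simp [Set.Ico_eq_empty (not_lt.2 h)]
  · rw [setIntegral_indicator measurableSet_Ici, Set.inter_comm, Set.Ici_inter_Iio]
    rcases le_total a t with h | h
    · rw [integral_Ico_eq_integral_Ioc, ← intervalIntegral.integral_of_le h,
        max_eq_left (sub_nonneg.2 h), intervalIntegral.integral_comp_sub_left
          (fun s => s ^ (γ - 1)), sub_self, integral_rpow (Or.inl (by linarith))]
      simp [h0.ne']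
    · rw [Set.Ico_eq_empty (not_lt.2 h), max_eq_right (by linarith), Real.zero_rpow h0.ne']
      simp

theorem hasIntegral_marchaud_indicator_Iio {γ : ℝ} (h0 : 0 < γ) (b t : ℝ) :
    IntegrableOn (fun s => ((Set.Iio b).indicator 1 t - (Set.Iio b).indicator 1 (t + s))
        * s ^ (-γ - 1)) (Set.Ioi 0) ∧
      ∫ s in Set.Ioi (0 : ℝ), ((Set.Iio b).indicator 1 t - (Set.Iio b).indicator 1 (t + s))
        * s ^ (-γ - 1) = max (b - t) 0 ^ (-γ) / γ := by
  rcases lt_or_ge t b with h | h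
  · have hbt := sub_pos.2 h
    have heq : (fun s => ((Set.Iio b).indicator (1 : ℝ → ℝ) t
        - (Set.Iio b).indicator 1 (t + s)) * s ^ (-γ - 1))
        = (Set.Ici (b - t)).indicator (fun s => s ^ (-γ - 1)) := by
      ext s
      by_cases hs : b ≤ t + s
      · rw [Set.indicator_of_mem (show t ∈ Set.Iio b from h),
          Set.indicator_of_notMem (show t + s ∉ Set.Iio b from not_lt.2 hs),
          Set.indicator_of_mem (show s ∈ Set.Ici (b - t) from sub_le_iff_le_add'.2 hs)]
        simp
      · rw [Set.indicator_of_mem (show t ∈ Set.Iio b from h),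
          Set.indicator_of_mem (show t + s ∈ Set.Iio b from not_le.1 hs),
          Set.indicator_of_notMem (show s ∉ Set.Ici (b - t) from
            fun h' => hs (sub_le_iff_le_add'.1 h'))]
        simp
    have hsub : Set.Ici (b - t) ⊆ Set.Ioi 0 := fun s hs => hbt.trans_le hs
    rw [heq, integrableOn_indicator_iff measurableSet_Ici, setIntegral_indicator measurableSet_Ici,
      Set.inter_eq_left.2 hsub, Set.inter_eq_right.2 hsub, max_eq_left hbt.le,
      integrableOn_Ici_iff_integrableOn_Ioi, integral_Ici_eq_integral_Ioi,
      integral_Ioi_rpow_of_lt (by linarith) hbt]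
    refine ⟨integrableOn_Ioi_rpow_of_lt (by linarith) hbt, ?_⟩
    rw [sub_add_cancel, neg_div_neg_eq]
  · have heq : Set.EqOn (fun s => ((Set.Iio b).indicator (1 : ℝ → ℝ) t
        - (Set.Iio b).indicator 1 (t + s)) * s ^ (-γ - 1)) (fun _ => 0) (Set.Ioi 0) := by
      intro s hs
      have hs' : (0 : ℝ) < s := hs
      simp [not_lt.2 h, show ¬ t + s < b by linarith]
    rw [integrableOn_congr_fun heq measurableSet_Ioi, setIntegral_congr_fun measurableSet_Ioi heq,
      max_eq_right (by linarith), Real.zero_rpow (by linarith)]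
    simp

theorem stepFun_eq_sum_indicator_Ici (T : ℝ) (hT : 0 ≤ T) (N : ℕ) (u : Fin N → ℝ) (t : ℝ) :
    stepFun T N u t = ∑ i : Fin N, u i * ((Set.Ici ((i : ℝ) * (T / N))).indicator 1 t
      - (Set.Ici (((i : ℝ) + 1) * (T / N))).indicator 1 t) := by
  refine Finset.sum_congr rfl fun i _ => ?_
  have hle : (i : ℝ) * (T / N) ≤ ((i : ℝ) + 1) * (T / N) := by gcongr; linarith
  simp only [Set.indicator_apply, Set.mem_Ico, Set.mem_Ici, Pi.one_apply]
  split_ifs <;> grind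

theorem stepFun_eq_sum_indicator_Iio (T : ℝ) (hT : 0 ≤ T) (N : ℕ) (u : Fin N → ℝ) (t : ℝ) :
    stepFun T N u t = ∑ i : Fin N, u i * ((Set.Iio (((i : ℝ) + 1) * (T / N))).indicator 1 t
      - (Set.Iio ((i : ℝ) * (T / N))).indicator 1 t) := by
  refine Finset.sum_congr rfl fun i _ => ?_
  have hle : (i : ℝ) * (T / N) ≤ ((i : ℝ) + 1) * (T / N) := by gcongr; linarith
  simp only [Set.indicator_apply, Set.mem_Ico, Set.mem_Iio, Pi.one_apply]
  split_ifs <;> grind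

theorem fracIntPlus_stepFun {γ T : ℝ} (h0 : 0 < γ) (hT : 0 ≤ T) (N : ℕ) (u : Fin N → ℝ) (t : ℝ) :
    fracIntPlus γ (stepFun T N u) t = (1 / Real.Gamma (γ + 1)) *
      ∑ i : Fin N, u i * (max (t - (i : ℝ) * (T / N)) 0 ^ γ
        - max (t - ((i : ℝ) + 1) * (T / N)) 0 ^ γ) := by
  have hI := hasIntegral_fracInt_indicator_Ici h0
  have heq : ∀ s, (t - s) ^ (γ - 1) * stepFun T N u s = ∑ i : Fin N, u i *
      ((t - s) ^ (γ - 1) * (Set.Ici ((i : ℝ) * (T / N))).indicator 1 s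
        - (t - s) ^ (γ - 1) * (Set.Ici (((i : ℝ) + 1) * (T / N))).indicator 1 s) := fun s => by
    rw [stepFun_eq_sum_indicator_Ici T hT, Finset.mul_sum]
    exact Finset.sum_congr rfl fun i _ => by ring
  rw [fracIntPlus]
  simp_rw [heq]
  rw [integral_finsetSum]
  swap
  · exact fun i _ => ((hI _ t).1.sub (hI _ t).1).const_mul _
  simp_rw [integral_const_mul]
  rw [Real.Gamma_add_one h0.ne', Finset.mul_sum, Finset.mul_sum]
  refine Finset.sum_congr rfl fun i _ => ?_
  rw [integral_sub (hI _ t).1 (hI _ t).1, (hI _ t).2, (hI _ t).2]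
  have := (Real.Gamma_pos_of_pos h0).ne'
  field_simp

theorem marchaudDMinus_stepFun {γ T : ℝ} (h0 : 0 < γ) (hT : 0 ≤ T) (N : ℕ) (u : Fin N → ℝ)
    (t : ℝ) :
    marchaudDMinus γ (stepFun T N u) t = (1 / Real.Gamma (1 - γ)) *
      ∑ i : Fin N, u i * (max (((i : ℝ) + 1) * (T / N) - t) 0 ^ (-γ)
        - max ((i : ℝ) * (T / N) - t) 0 ^ (-γ)) := by
  have hI := hasIntegral_marchaud_indicator_Iio h0
  have heq : ∀ s, (stepFun T N u t - stepFun T N u (t + s)) * s ^ (-γ - 1) = ∑ i : Fin N, u i *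
      (((Set.Iio (((i : ℝ) + 1) * (T / N))).indicator 1 t
          - (Set.Iio (((i : ℝ) + 1) * (T / N))).indicator 1 (t + s)) * s ^ (-γ - 1)
        - ((Set.Iio ((i : ℝ) * (T / N))).indicator 1 t
          - (Set.Iio ((i : ℝ) * (T / N))).indicator 1 (t + s)) * s ^ (-γ - 1)) := fun s => by
    rw [stepFun_eq_sum_indicator_Iio T hT, stepFun_eq_sum_indicator_Iio T hT,
      ← Finset.sum_sub_distrib, Finset.sum_mul]
    exact Finset.sum_congr rfl fun i _ => by ring
  rw [marchaudDMinus]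
  simp_rw [heq]
  rw [integral_finsetSum]
  swap
  · exact fun i _ => ((hI _ t).1.sub (hI _ t).1).const_mul _
  simp_rw [integral_const_mul]
  rw [Finset.mul_sum, Finset.mul_sum]
  refine Finset.sum_congr rfl fun i _ => ?_
  rw [integral_sub (hI _ t).1 (hI _ t).1, (hI _ t).2, (hI _ t).2]
  field_simp

theorem memLp_max_rpow_neg {γ : ℝ} (h0 : 0 < γ) (h1 : γ < 1 / 2) (b T : ℝ) :
    MemLp (fun t => max (b - t) 0 ^ (-γ)) 2 (volume.restrict (Set.Icc 0 T)) := by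
  have hmeas : Measurable fun t : ℝ => max (b - t) 0 ^ (-γ) := by fun_prop
  refine (memLp_two_iff_integrable_sq hmeas.aestronglyMeasurable).2 ?_
  have heq : (fun t : ℝ => (max (b - t) 0 ^ (-γ)) ^ 2)
      = (Set.Iio b).indicator fun t => (b - t) ^ (-(2 * γ)) := by
    ext t
    by_cases h : t < b
    · rw [Set.indicator_of_mem (show t ∈ Set.Iio b from h), max_eq_left (by linarith),
        ← Real.rpow_mul_natCast (by linarith)]
      congr 1
      push_cast
      ring
    · rw [Set.indicator_of_notMem (show t ∉ Set.Iio b from h), max_eq_right (by linarith),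
        Real.zero_rpow (by linarith)]
      norm_num
  rw [heq]
  refine Integrable.indicator ?_ measurableSet_Iio
  have hint : IntervalIntegrable (fun s => (b - s) ^ (-(2 * γ))) volume 0 T := by
    simpa using ((intervalIntegral.intervalIntegrable_rpow' (a := b) (b := b - T)
      (by linarith : -1 < -(2 * γ))).comp_sub_left b)
  rcases le_total 0 T with h | h
  · exact (intervalIntegrable_iff_integrableOn_Icc_of_le h).1 hint
  · exact IntegrableOn.mono_set (t := Set.Icc 0 0) (by simp) (Set.Icc_subset_Icc_right h)

theorem continuous_max_rpow {γ : ℝ} (h0 : 0 < γ) (a : ℝ) :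
    Continuous fun t : ℝ => max (t - a) 0 ^ γ :=
  ((continuous_id.sub continuous_const).max continuous_const).rpow_const fun _ => Or.inr h0.le

theorem rpow_add_sub_rpow_le {γ x c : ℝ} (h0 : 0 ≤ γ) (h1 : γ ≤ 1) (hx : 0 < x) (hc : 0 ≤ c) :
    (x + c) ^ γ - x ^ γ ≤ γ * c * x ^ (γ - 1) := by
  have hcx : 0 ≤ c / x := by positivity
  have h := rpow_one_add_le_one_add_mul_self (s := c / x) (by linarith) h0 h1
  have hxc : x + c = x * (1 + c / x) := by field_simp
  rw [hxc, Real.mul_rpow hx.le (by linarith), Real.rpow_sub_one hx.ne']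
  have := mul_le_mul_of_nonneg_left h (Real.rpow_nonneg hx.le γ)
  calc x ^ γ * (1 + c / x) ^ γ - x ^ γ ≤ x ^ γ * (1 + γ * (c / x)) - x ^ γ := by linarith
    _ = γ * c * (x ^ γ / x) := by ring

theorem memLp_max_rpow_sub_max_rpow {γ a b : ℝ} (h0 : 0 < γ) (h1 : γ < 1 / 2) (hab : a ≤ b) :
    MemLp (fun t => max (t - a) 0 ^ γ - max (t - b) 0 ^ γ) 2 volume := by
  have hcont : Continuous fun t : ℝ => max (t - a) 0 ^ γ - max (t - b) 0 ^ γ :=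
    (continuous_max_rpow h0 a).sub (continuous_max_rpow h0 b)
  refine (memLp_two_iff_integrable_sq hcont.aestronglyMeasurable).2 ?_
  have hsplit : (Set.univ : Set ℝ) = Set.Iio a ∪ (Set.Icc a (b + 1) ∪ Set.Ioi (b + 1)) := by
    ext t
    simp only [Set.mem_univ, Set.mem_union, Set.mem_Iio, Set.mem_Icc, Set.mem_Ioi, true_iff]
    grind
  rw [← integrableOn_univ, hsplit]
  refine IntegrableOn.union ?_ (IntegrableOn.union (hcont.pow 2).integrableOn_Icc ?_)
  · refine (integrableOn_congr_fun (g := fun _ => (0 : ℝ)) (fun t ht => ?_) measurableSet_Iio).2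
      (by simp)
    have ht' : t < a := ht
    simp only [max_eq_right (by linarith : t - a ≤ 0), max_eq_right (by linarith : t - b ≤ 0),
      sub_self]
    norm_num
  · have hdom : IntegrableOn (fun t : ℝ => (γ * (b - a)) ^ 2 * (t - b) ^ (2 * (γ - 1)))
        (Set.Ioi (b + 1)) := by
      refine Integrable.const_mul ?_ _
      have := integrableOn_add_rpow_Ioi_of_lt (m := -b) (a := 2 * (γ - 1)) (c := b + 1)
        (by linarith) (by linarith)
      simpa only [sub_eq_add_neg] using this.integrable
    refine Integrable.mono' hdom (hcont.pow 2).aestronglyMeasurable ?_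
    refine (ae_restrict_iff' measurableSet_Ioi).2 (ae_of_all _ fun t ht => ?_)
    have ht' : b + 1 < t := ht
    have hx : 0 < t - b := by linarith
    have h := rpow_add_sub_rpow_le h0.le (by linarith : γ ≤ 1) hx (sub_nonneg.2 hab)
    rw [show t - b + (b - a) = t - a by ring] at h
    have hnn : (t - b) ^ γ ≤ (t - a) ^ γ := Real.rpow_le_rpow hx.le (by linarith) h0.le
    simp only [Real.norm_eq_abs, abs_sq, max_eq_left hx.le,
      max_eq_left (by linarith : 0 ≤ t - a)]
    calc ((t - a) ^ γ - (t - b) ^ γ) ^ 2 ≤ (γ * (b - a) * (t - b) ^ (γ - 1)) ^ 2 := by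
          gcongr
      _ = (γ * (b - a)) ^ 2 * (t - b) ^ (2 * (γ - 1)) := by
          rw [mul_pow, ← Real.rpow_mul_natCast hx.le]
          congr 2
          push_cast
          ring

/-- Fractional integration-by-parts estimate for step functions, `H > 1/2`, `γ = H − 1/2`:
`∫_ℝ f² ≤ (∫_ℝ (I_+^γ f)²)^{1/2} (∫_0^T (D_−^γ f)²)^{1/2}`. -/
theorem stepFun_L2_le_fracInt_mul_marchaud
    (H γ T : ℝ) (hH : H ∈ Set.Ioo (1 / 2 : ℝ) 1) (hγ : γ = H - 1 / 2) (hT : 0 < T) :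
    ∀ N : ℕ, 0 < N → ∀ u : Fin N → ℝ,
      (∫ t : ℝ, (stepFun T N u t) ^ 2)
        ≤ Real.sqrt (∫ t : ℝ, (fracIntPlus γ (stepFun T N u) t) ^ 2) *
            Real.sqrt (∫ t in (0 : ℝ)..T, (marchaudDMinus γ (stepFun T N u) t) ^ 2) := by
  intro N hN u
  have h0 : 0 < γ := by linarith [hH.1]
  have h1 : γ < 1 / 2 := by linarith [hH.2]
  have hN' : (0 : ℝ) < N := Nat.cast_pos.2 hN
  set f := stepFun T N u with hf
  set a : Fin N → ℝ := fun i => (i : ℝ) * (T / N) with ha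
  set b : Fin N → ℝ := fun i => ((i : ℝ) + 1) * (T / N) with hb
  have haT : ∀ i, a i ∈ Set.Icc 0 T := fun i => by
    have hi : (i : ℝ) ≤ N := by exact_mod_cast i.2.le
    refine ⟨by positivity, ?_⟩
    calc (i : ℝ) * (T / N) ≤ N * (T / N) := by gcongr
      _ = T := by field_simp
  have hbT : ∀ i, b i ∈ Set.Icc 0 T := fun i => by
    have hi : (i : ℝ) + 1 ≤ N := by exact_mod_cast i.2
    refine ⟨by positivity, ?_⟩
    calc ((i : ℝ) + 1) * (T / N) ≤ N * (T / N) := by gcongr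
      _ = T := by field_simp
  have hab : ∀ i, a i ≤ b i := fun i =>
    mul_le_mul_of_nonneg_right (by linarith) (by positivity)
  have hG1 := Real.Gamma_pos_of_pos (show 0 < γ + 1 by linarith)
  have hG2 := Real.Gamma_pos_of_pos (show 0 < 1 - γ by linarith)
  have hIf : ∀ t, fracIntPlus γ f t = (1 / Real.Gamma (γ + 1)) *
      ∑ i, u i * (max (t - a i) 0 ^ γ - max (t - b i) 0 ^ γ) :=
    fracIntPlus_stepFun h0 hT.le N u
  have hDf : ∀ t, marchaudDMinus γ f t = (1 / Real.Gamma (1 - γ)) *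
      ∑ i, u i * (max (b i - t) 0 ^ (-γ) - max (a i - t) 0 ^ (-γ)) :=
    marchaudDMinus_stepFun h0 hT.le N u
  have hI2 : MemLp (fracIntPlus γ f) 2 volume := by
    rw [funext hIf]
    exact (memLp_finsetSum _ fun i _ =>
      (memLp_max_rpow_sub_max_rpow h0 h1 (hab i)).const_mul _).const_mul _
  have hD2 : MemLp (marchaudDMinus γ f) 2 (volume.restrict (Set.Icc 0 T)) := by
    rw [funext hDf]
    exact (memLp_finsetSum _ fun i _ =>
      ((memLp_max_rpow_neg h0 h1 _ T).sub (memLp_max_rpow_neg h0 h1 _ T)).const_mul _).const_mul _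
  have hfsq : ∫ t, f t ^ 2 = ∑ i, ∑ j, u i * u j * (max (b j - a i) 0 - max (a j - a i) 0
      - (max (b j - b i) 0 - max (a j - b i) 0)) := by
    have hzero : ∀ t, t ∉ Set.Icc 0 T → f t ^ 2 = 0 := fun t ht => by
      rw [hf, stepFun, Finset.sum_eq_zero fun i _ => Set.indicator_of_notMem
        (fun h => ht ⟨(haT i).1.trans h.1, h.2.le.trans (hbT i).2⟩) _]
      norm_num
    rw [← setIntegral_eq_integral_of_forall_compl_eq_zero hzero,
      ← integral_sum_sub_mul_sum_sub (μ := volume.restrict (Set.Icc 0 T)) (s := Set.Icc 0 T)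
        (φ := fun x => (Set.Ici x).indicator 1) (ψ := fun y => (Set.Iio y).indicator 1)
        (m := fun x y => max (y - x) 0) u haT hbT]
    · refine setIntegral_congr_fun measurableSet_Icc fun t _ => ?_
      simp only [sq]
      nth_rewrite 1 [hf, stepFun_eq_sum_indicator_Ici T hT.le]
      rw [hf, stepFun_eq_sum_indicator_Iio T hT.le]
    · intro x _ y _
      have hone : IntegrableOn (1 : ℝ → ℝ) (Set.Icc 0 T) :=
        continuous_one.integrableOn_Icc
      have h := (hone.integrable.indicator measurableSet_Iio).indicator
        (measurableSet_Ici (a := x)) (f := (Set.Iio y).indicator (1 : ℝ → ℝ))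
      refine h.congr (ae_of_all _ fun t => ?_)
      by_cases ht : t ∈ Set.Ici x <;> simp [ht]
    · exact fun x hx y hy => setIntegral_indicator_Ici_mul_indicator_Iio hx.1 hy.2
  have hprod : ∫ t in Set.Icc 0 T, fracIntPlus γ f t * marchaudDMinus γ f t
      = ∫ t, f t ^ 2 := by
    have h := integral_sum_sub_mul_sum_sub (μ := volume.restrict (Set.Icc 0 T))
      (s := Set.Icc 0 T) (φ := fun x t => max (t - x) 0 ^ γ)
      (ψ := fun y t => max (y - t) 0 ^ (-γ))
      (m := fun x y => max (y - x) 0 * (Real.Gamma (γ + 1) * Real.Gamma (1 - γ))) u haT hbT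
      (fun x _ y _ => MemLp.integrable_mul
        ((memLp_two_iff_integrable_sq (continuous_max_rpow h0 x).aestronglyMeasurable).2
          ((continuous_max_rpow h0 x).pow 2).integrableOn_Icc) (memLp_max_rpow_neg h0 h1 y T))
      fun x hx y hy => setIntegral_max_rpow_mul_max_rpow_neg h0 (by linarith) hx.1 hy.2
    simp_rw [hIf, hDf, mul_mul_mul_comm (1 / Real.Gamma (γ + 1))]
    rw [integral_const_mul, h, hfsq, Finset.mul_sum]
    refine Finset.sum_congr rfl fun i _ => ?_
    rw [Finset.mul_sum]
    refine Finset.sum_congr rfl fun j _ => ?_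
    field_simp
  rw [← hprod, intervalIntegral.integral_of_le hT.le, ← integral_Icc_eq_integral_Ioc]
  refine (integral_mul_le_sqrt_mul_sqrt (hI2.restrict _) hD2).trans ?_
  gcongr
  · exact ae_of_all _ fun t => sq_nonneg _
  · exact hI2.integrable_sq
  · exact Measure.restrict_le_self
end
end
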